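/- Let λ > 1, and define Q_r(u,v) = r!·Vol(S_r(u,v)) for the set S_r(u,v) = {ξ ∈ ℝ^r : 0 ≤ ξ₁ ≤ ⋯ ≤ ξ_r ≤ 1, ξᵢ ≥ (i−u)/v for all i}. If 1 ≤ u ≤ r and v = r + 1 − u, then Q_r(u, r+1−u) ≥ (u − 1/2)/(r + 1/2). -/

import Mathlib

namespace Stmt11

open MeasureTheory

/-- Periodic walk lemma. -/
lemma walk_count (r : ℕ) (u : ℝ) (W : ℕ → ℝ)
    (hper : ∀ j, W (j + (r + 1)) = W j - u) (hstep : ∀ j, W j - 1 ≤ W (j + 1)) :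
    ∃ G : Finset ℕ, G ⊆ Finset.range (r + 1) ∧ u ≤ (G.card : ℝ) ∧
      ∀ m ∈ G, ∀ i, 1 ≤ i → i ≤ r → W (m + (r + 1)) ≤ W (m + i) := by
  classical
  set P : ℕ → Prop := fun m => ∀ i, 1 ≤ i → i ≤ r → W (m + (r + 1)) ≤ W (m + i) with hP
  have hne : (Finset.range (r + 1)).Nonempty := ⟨0, by simp⟩
  set M : ℕ → ℝ := fun m => (Finset.range (r + 1)).inf' hne (fun i => W (m + i)) with hM
  have hMle : ∀ m i, i ≤ r → M m ≤ W (m + i) := fun m i hi =>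
    Finset.inf'_le _ (by simp; omega)
  have hle : ∀ m a, (∀ i, i ≤ r → a ≤ W (m + i)) → a ≤ M m := fun m a h =>
    Finset.le_inf' _ _ (fun i hi => h i (by simp at hi; omega))
  have key : ∀ m, M m - M (m + 1) ≤ if P m then (1 : ℝ) else 0 := by
    intro m
    split_ifs with h
    · have : M m - 1 ≤ M (m + 1) := by
        apply hle
        intro i hi
        have h1 := hMle m i hi
        have h2 := hstep (m + i)
        rw [show m + 1 + i = m + i + 1 by ring]
        linarith
      linarith
    · have : M m ≤ M (m + 1) := by
        apply hle
        intro i hi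
        rcases Nat.lt_or_ge i r with h1 | h1
        · have := hMle m (i + 1) h1
          rwa [show m + 1 + i = m + (i + 1) by ring]
        · have hir : i = r := by omega
          subst hir
          simp only [hP] at h
          push Not at h
          obtain ⟨k, hk1, hk2, hk3⟩ := h
          have := hMle m k hk2
          rw [show m + 1 + i = m + (i + 1) by ring]
          linarith
      linarith
  have hend : M (r + 1) ≤ M 0 - u := by
    have : M (r + 1) + u ≤ M 0 := by
      apply hle
      intro i hi
      have h1 := hMle (r + 1) i hi
      have h2 := hper i
      rw [show r + 1 + i = i + (r + 1) by ring] at h1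
      rw [zero_add]
      linarith
    linarith
  refine ⟨(Finset.range (r + 1)).filter P, Finset.filter_subset _ _, ?_, ?_⟩
  · have h1 := Finset.sum_le_sum (s := Finset.range (r + 1)) (fun m _ => key m)
    rw [Finset.sum_range_sub' M, Finset.sum_boole] at h1
    linarith
  · intro m hm
    exact (Finset.mem_filter.mp hm).2

/-- periodic extension -/
noncomputable def X (r : ℕ) (c : ℝ) (ξ : Fin r → ℝ) (n : ℕ) : ℝ :=
  c * ((n / (r + 1) : ℕ) : ℝ) +
    if h : 0 < n % (r + 1) then
      ξ ⟨n % (r + 1) - 1, by have := Nat.mod_lt n (show r + 1 > 0 by omega); omega⟩ else 0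

/-- rotation -/
noncomputable def T (r : ℕ) (c : ℝ) (ξ : Fin r → ℝ) : Fin r → ℝ :=
  fun i => X r c ξ ((i : ℕ) + 2) - X r c ξ 1

lemma X_zero (r : ℕ) (c : ℝ) (ξ : Fin r → ℝ) : X r c ξ 0 = 0 := by simp [X]

lemma X_succ (r : ℕ) (c : ℝ) (ξ : Fin r → ℝ) (i : ℕ) (hi : i < r) :
    X r c ξ (i + 1) = ξ ⟨i, hi⟩ := by
  have h1 : (i + 1) / (r + 1) = 0 := Nat.div_eq_of_lt (by omega)
  have h2 : (i + 1) % (r + 1) = i + 1 := Nat.mod_eq_of_lt (by omega)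
  simp [X, h1, h2]

lemma X_per (r : ℕ) (c : ℝ) (ξ : Fin r → ℝ) (n q : ℕ) :
    X r c ξ (n + (r + 1) * q) = X r c ξ n + c * q := by
  have h1 : (n + (r + 1) * q) / (r + 1) = n / (r + 1) + q :=
    Nat.add_mul_div_left _ _ (Nat.succ_pos r)
  have h2 : (n + (r + 1) * q) % (r + 1) = n % (r + 1) := Nat.add_mul_mod_self_left _ _ _
  simp only [X, h1, h2]
  push_cast
  ring

lemma X_T (r : ℕ) (c : ℝ) (ξ : Fin r → ℝ) (n : ℕ) :
    X r c (T r c ξ) n = X r c ξ (n + 1) - X r c ξ 1 := by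
  obtain ⟨p, q, hp, rfl⟩ : ∃ p q, p < r + 1 ∧ n = p + (r + 1) * q :=
    ⟨n % (r + 1), n / (r + 1), Nat.mod_lt _ (Nat.succ_pos r), (Nat.mod_add_div _ _).symm⟩
  rw [show p + (r + 1) * q + 1 = (p + 1) + (r + 1) * q by ring, X_per, X_per]
  rcases p with _ | p
  · rw [X_zero]; ring
  · rw [X_succ _ _ _ p (by omega)]
    simp only [T]
    ring

lemma X_iter (r : ℕ) (c : ℝ) (m : ℕ) : ∀ (ξ : Fin r → ℝ) (n : ℕ),
    X r c ((T r c)^[m] ξ) n = X r c ξ (n + m) - X r c ξ m := by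
  induction m with
  | zero => intro ξ n; simp [X_zero]
  | succ m ih =>
    intro ξ n
    rw [Function.iterate_succ_apply, ih, X_T, X_T]
    rw [show n + m + 1 = n + (m + 1) by ring]
    ring

lemma X_step (r : ℕ) (ξ : Fin r → ℝ) (hmono : ∀ i j : Fin r, i ≤ j → ξ i ≤ ξ j)
    (h01 : ∀ i, 0 ≤ ξ i ∧ ξ i ≤ 1) (n : ℕ) : X r 1 ξ n ≤ X r 1 ξ (n + 1) := by
  obtain ⟨p, q, hp, rfl⟩ : ∃ p q, p < r + 1 ∧ n = p + (r + 1) * q :=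
    ⟨n % (r + 1), n / (r + 1), Nat.mod_lt _ (Nat.succ_pos r), (Nat.mod_add_div _ _).symm⟩
  rw [show p + (r + 1) * q + 1 = (p + 1) + (r + 1) * q by ring, X_per, X_per]
  apply add_le_add_left
  rcases Nat.lt_or_ge p r with h | h
  · rw [X_succ _ _ _ p h]
    rcases p with _ | p
    · rw [X_zero]; exact (h01 _).1
    · rw [X_succ _ _ _ p (by omega)]
      apply hmono
      simp [Fin.le_def]
  · have hpr : p = r := by omega
    subst hpr
    have h2 := X_per p 1 ξ 0 1
    rw [X_zero, zero_add, mul_one] at h2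
    rw [h2]
    rcases p with _ | p
    · rw [X_zero]; norm_num
    · rw [X_succ _ _ _ p (by omega)]
      simpa using (h01 _).2

/-- linear part -/
noncomputable def L (r : ℕ) : (Fin r → ℝ) →ₗ[ℝ] (Fin r → ℝ) where
  toFun := T r 0
  map_add' := by
    intro x y
    funext i
    simp only [T, X, Pi.add_apply]
    split_ifs <;> ring
  map_smul' := by
    intro a x
    funext i
    simp only [T, X, Pi.smul_apply, smul_eq_mul, RingHom.id_apply]
    split_ifs <;> ring

lemma T_eq (r : ℕ) (ξ : Fin r → ℝ) : T r 1 ξ = L r ξ + T r 1 0 := by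
  funext i
  simp only [L, LinearMap.coe_mk, AddHom.coe_mk, T, X, Pi.add_apply, Pi.zero_apply]
  split_ifs <;> ring

lemma L_pow (r : ℕ) : (L r) ^ (r + 1) = 1 := by
  refine LinearMap.ext fun x => ?_
  have h0 : ((L r) ^ (r + 1)) x = (T r 0)^[r + 1] x := by
    rw [Module.End.pow_apply]
    rfl
  rw [h0, Module.End.one_apply]
  funext i
  have h1 := X_iter r 0 (r + 1) x (i + 1)
  rw [X_succ _ _ _ _ i.2] at h1
  have h2 := X_per r 0 x (i + 1) 1
  have h3 := X_per r 0 x 0 1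
  rw [X_zero, zero_add, mul_one] at h3
  rw [X_succ _ _ _ _ i.2, mul_one] at h2
  rw [h2, h3] at h1
  simpa using h1

lemma det_L (r : ℕ) : |LinearMap.det (L r)| = 1 := by
  have h : (LinearMap.det (L r)) ^ (r + 1) = 1 := by
    rw [← map_pow, L_pow, map_one]
  have h2 : |LinearMap.det (L r)| ^ (r + 1) = 1 := by rw [← abs_pow, h, abs_one]
  exact (pow_eq_one_iff_of_nonneg (abs_nonneg _) (by omega)).1 h2

lemma vol_T (r : ℕ) (A : Set (Fin r → ℝ)) : volume (T r 1 ⁻¹' A) = volume A := by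
  have h0 : LinearMap.det (L r) ≠ 0 := by
    intro h
    have := det_L r
    rw [h] at this
    simp at this
  have h1 : T r 1 ⁻¹' A = (L r) ⁻¹' ((fun x => x + T r 1 0) ⁻¹' A) := by
    ext x
    simp [T_eq r x]
  rw [h1, Measure.addHaar_preimage_linearMap _ h0, measure_preimage_add_right, abs_inv, det_L]
  simp

lemma vol_iter (r : ℕ) (A : Set (Fin r → ℝ)) (m : ℕ) :
    volume ((T r 1)^[m] ⁻¹' A) = volume A := by
  induction m with
  | zero => simp
  | succ m ih =>
    rw [Function.iterate_succ, Set.preimage_comp, vol_T, ih]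

lemma meas_T (r : ℕ) : Measurable (T r 1) := by
  have : T r 1 = fun ξ => L r ξ + T r 1 0 := funext (T_eq r)
  rw [this]
  exact ((LinearMap.continuous_of_finiteDimensional (L r)).add continuous_const).measurable

/-- ordered simplex -/
def O (r : ℕ) : Set (Fin r → ℝ) :=
  {ξ | (∀ i j : Fin r, i ≤ j → ξ i ≤ ξ j) ∧ (∀ i, 0 ≤ ξ i ∧ ξ i ≤ 1)}

lemma vol_O (r : ℕ) : 1 ≤ (r.factorial : ENNReal) * volume (O r) := by
  have hcov : Set.Icc (0 : Fin r → ℝ) 1 ⊆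
      ⋃ σ : Equiv.Perm (Fin r), (fun ξ : Fin r → ℝ => ξ ∘ σ) ⁻¹' (O r) := by
    intro ξ hξ
    rw [Set.mem_iUnion]
    refine ⟨Tuple.sort ξ, fun i j hij => Tuple.monotone_sort ξ hij, fun i => ⟨hξ.1 _, hξ.2 _⟩⟩
  have hσ : ∀ σ : Equiv.Perm (Fin r),
      volume ((fun ξ : Fin r → ℝ => ξ ∘ σ) ⁻¹' (O r)) = volume (O r) := by
    intro σ
    have := (volume_measurePreserving_piCongrLeft (fun _ : Fin r => ℝ) σ.symm).measure_preimage_equiv (O r)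
    rw [← this]
    congr 1
    have hfun : (fun ξ : Fin r → ℝ => ξ ∘ σ) =
        ⇑(MeasurableEquiv.piCongrLeft (fun _ : Fin r => ℝ) σ.symm) := by
      funext ξ i
      have h := MeasurableEquiv.piCongrLeft_apply_apply (β := fun _ : Fin r => ℝ) σ.symm ξ (σ i)
      simp only [Equiv.symm_apply_apply] at h
      exact h.symm
    rw [hfun]
  calc (1 : ENNReal) = volume (Set.Icc (0 : Fin r → ℝ) 1) := by
        rw [Real.volume_Icc_pi]; simp
    _ ≤ _ := measure_mono hcov
    _ ≤ ∑ σ : Equiv.Perm (Fin r), volume ((fun ξ : Fin r → ℝ => ξ ∘ σ) ⁻¹' (O r)) :=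
        measure_iUnion_fintype_le _ _
    _ = _ := by
        simp [hσ, Fintype.card_perm]

/-- the set -/
def S (r : ℕ) (u : ℝ) : Set (Fin r → ℝ) :=
  {ξ : Fin r → ℝ |
          (∀ i j : Fin r, i ≤ j → ξ i ≤ ξ j) ∧
          (∀ i, 0 ≤ ξ i ∧ ξ i ≤ 1) ∧
          ∀ i : Fin r, (((i : ℕ) : ℝ) + 1 - u) / ((r : ℝ) + 1 - u) ≤ ξ i}

lemma meas_S (r : ℕ) (u : ℝ) : MeasurableSet (S r u) := by
  apply IsClosed.measurableSet
  simp only [S, Set.ofPred_and, Set.ofPred_forall]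
  refine IsClosed.inter ?_ (IsClosed.inter ?_ ?_)
  · exact isClosed_iInter fun i => isClosed_iInter fun j => isClosed_iInter fun _ =>
      isClosed_le (continuous_apply i) (continuous_apply j)
  · exact isClosed_iInter fun i => (isClosed_le continuous_const (continuous_apply i)).inter
      (isClosed_le (continuous_apply i) continuous_const)
  · exact isClosed_iInter fun i => isClosed_le continuous_const (continuous_apply i)

lemma count (r : ℕ) (u : ℝ) (hur : u ≤ r) (ξ : Fin r → ℝ) (hξ : ξ ∈ O r) :
    ∃ G : Finset ℕ, G ⊆ Finset.range (r + 1) ∧ u ≤ (G.card : ℝ) ∧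
      ∀ m ∈ G, (T r 1)^[m] ξ ∈ S r u := by
  have hv : 0 < (r : ℝ) + 1 - u := by linarith
  have hst := X_step r ξ hξ.1 hξ.2
  have hmono : Monotone (X r 1 ξ) := monotone_nat_of_le_succ hst
  have hper : ∀ j, X r 1 ξ (j + (r + 1)) = X r 1 ξ j + 1 := by
    intro j
    have := X_per r 1 ξ j 1
    simpa using this
  obtain ⟨G, hG, hc, hg⟩ := walk_count r u (fun n => ((r : ℝ) + 1 - u) * X r 1 ξ n - n)
    (by intro j; simp only [hper]; push_cast; ring)
    (by
      intro j
      have := mul_le_mul_of_nonneg_left (hst j) hv.le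
      push_cast
      linarith)
  refine ⟨G, hG, hc, fun m hm => ?_⟩
  have hval : ∀ i : Fin r, (T r 1)^[m] ξ i = X r 1 ξ (m + (i + 1)) - X r 1 ξ m := by
    intro i
    have h1 := X_iter r 1 m ξ (i + 1)
    rw [X_succ _ _ _ _ i.2] at h1
    rw [add_comm m, ← h1]
  refine ⟨fun i j hij => ?_, fun i => ⟨?_, ?_⟩, fun i => ?_⟩
  · rw [hval, hval]
    have := hmono (show m + ((i : ℕ) + 1) ≤ m + (j + 1) by
      have : (i : ℕ) ≤ j := hij
      omega)
    linarith
  · rw [hval]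
    have := hmono (show m ≤ m + ((i : ℕ) + 1) by omega)
    linarith
  · rw [hval]
    have := hmono (show m + ((i : ℕ) + 1) ≤ m + (r + 1) by omega)
    rw [hper] at this
    linarith
  · rw [hval, div_le_iff₀ hv]
    have := hg m hm (i + 1) (by omega) (by omega)
    simp only [hper] at this
    push_cast at this
    linarith

lemma main_bound (r : ℕ) (u : ℝ) (hur : u ≤ r) :
    ENNReal.ofReal u * volume (O r) ≤ ((r + 1 : ℕ) : ENNReal) * volume (S r u) := by
  classical
  have hm : ∀ m, MeasurableSet ((T r 1)^[m] ⁻¹' (S r u)) := fun m =>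
    ((meas_T r).iterate m) (meas_S r u)
  have hOm : MeasurableSet (O r) := by
    apply IsClosed.measurableSet
    simp only [O, Set.ofPred_and, Set.ofPred_forall]
    refine IsClosed.inter ?_ ?_
    · exact isClosed_iInter fun i => isClosed_iInter fun j => isClosed_iInter fun _ =>
        isClosed_le (continuous_apply i) (continuous_apply j)
    · exact isClosed_iInter fun i => (isClosed_le continuous_const (continuous_apply i)).inter
        (isClosed_le (continuous_apply i) continuous_const)
  calc ENNReal.ofReal u * volume (O r)
      = ∫⁻ _ξ in O r, ENNReal.ofReal u := by rw [setLIntegral_const]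
    _ ≤ ∫⁻ ξ in O r, ∑ m ∈ Finset.range (r + 1),
          ((T r 1)^[m] ⁻¹' (S r u)).indicator (fun _ => (1 : ENNReal)) ξ := by
        apply setLIntegral_mono' hOm
        intro ξ hξ
        obtain ⟨G, hG, hc, hg⟩ := count r u hur ξ hξ
        calc ENNReal.ofReal u ≤ ENNReal.ofReal (G.card : ℝ) := ENNReal.ofReal_le_ofReal hc
          _ = ∑ m ∈ G, (1 : ENNReal) := by simp
          _ = ∑ m ∈ G, ((T r 1)^[m] ⁻¹' (S r u)).indicator (fun _ => (1 : ENNReal)) ξ := by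
              apply Finset.sum_congr rfl
              intro m hm
              rw [Set.indicator_of_mem]
              exact hg m hm
          _ ≤ _ := Finset.sum_le_sum_of_subset hG
    _ ≤ ∫⁻ ξ, ∑ m ∈ Finset.range (r + 1),
          ((T r 1)^[m] ⁻¹' (S r u)).indicator (fun _ => (1 : ENNReal)) ξ :=
        setLIntegral_le_lintegral _ _
    _ = ∑ m ∈ Finset.range (r + 1), volume (S r u) := by
        rw [lintegral_finsetSum _ (fun m _ => measurable_const.indicator (hm m))]
        apply Finset.sum_congr rfl
        intro m _
        rw [lintegral_indicator (hm m), setLIntegral_const, one_mul, vol_iter]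
    _ = _ := by simp

end Stmt11

theorem stmt_11 (r : ℕ) (hr : 1 ≤ r) (u : ℝ) (hu1 : 1 ≤ u) (hur : u ≤ r) :
    (u - 1/2) / ((r : ℝ) + 1/2) ≤
      (r.factorial : ℝ) *
        (MeasureTheory.volume {ξ : Fin r → ℝ |
          (∀ i j : Fin r, i ≤ j → ξ i ≤ ξ j) ∧
          (∀ i, 0 ≤ ξ i ∧ ξ i ≤ 1) ∧
          ∀ i : Fin r, (((i : ℕ) : ℝ) + 1 - u) / ((r : ℝ) + 1 - u) ≤ ξ i}).toReal := by
  change _ ≤ (r.factorial : ℝ) * (MeasureTheory.volume (Stmt11.S r u)).toReal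
  have hfin : MeasureTheory.volume (Stmt11.S r u) ≠ ⊤ := by
    have h1 : Stmt11.S r u ⊆ Set.Icc (0 : Fin r → ℝ) 1 :=
      fun ξ h => ⟨fun i => (h.2.1 i).1, fun i => (h.2.1 i).2⟩
    have h2 := MeasureTheory.measure_mono (μ := MeasureTheory.volume) h1
    refine ne_top_of_le_ne_top ?_ h2
    rw [Real.volume_Icc_pi]; simp
  have hA : ENNReal.ofReal u ≤
      ((r + 1 : ℕ) : ENNReal) * ((r.factorial : ENNReal) * MeasureTheory.volume (Stmt11.S r u)) := by
    calc ENNReal.ofReal u = ENNReal.ofReal u * 1 := (mul_one _).symm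
      _ ≤ ENNReal.ofReal u * ((r.factorial : ENNReal) * MeasureTheory.volume (Stmt11.O r)) := by
          gcongr; exact Stmt11.vol_O r
      _ = (r.factorial : ENNReal) * (ENNReal.ofReal u * MeasureTheory.volume (Stmt11.O r)) := by
          ring
      _ ≤ (r.factorial : ENNReal) *
            (((r + 1 : ℕ) : ENNReal) * MeasureTheory.volume (Stmt11.S r u)) := by
          exact mul_le_mul_right (Stmt11.main_bound r u hur) _
      _ = _ := by ring
  have hB := ENNReal.toReal_mono (by
    exact ENNReal.mul_ne_top (ENNReal.natCast_ne_top _)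
      (ENNReal.mul_ne_top (ENNReal.natCast_ne_top _) hfin)) hA
  rw [ENNReal.toReal_ofReal (by linarith), ENNReal.toReal_mul, ENNReal.toReal_mul,
    ENNReal.toReal_natCast, ENNReal.toReal_natCast] at hB
  push_cast at hB
  set Q := (r.factorial : ℝ) * (MeasureTheory.volume (Stmt11.S r u)).toReal
  have hr0 : (0 : ℝ) < (r : ℝ) + 1 := by positivity
  have hQ : u / ((r : ℝ) + 1) ≤ Q := by
    rw [div_le_iff₀ hr0]; linarith
  refine le_trans ?_ hQ
  rw [div_le_div_iff₀ (by positivity) hr0]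
  nlinarith
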